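/- arXiv:2002.03296 — 2 statements merged into one kernel-verified Lean document; each statement's English description precedes it below -/
import Mathlib

section
/- For all integers n ≥ 1, all integers 0 ≤ k ≤ τ(n) where τ(n) := (1/2)(n/2 + 2 − √(n/2+2)), and all integers 2 ≤ i ≤ n−2, one has K_k^(n)(2) ≥ |K_k^(n)(i)|. -/
noncomputable section

/-- Generalized binomial coefficient `C(x, j) = x(x-1)⋯(x-j+1)/j!` for real `x`. -/
def rchoose (x : ℝ) (j : ℕ) : ℝ := (∏ i ∈ Finset.range j, (x - i)) / (Nat.factorial j)

/-- Krawtchouk polynomial `K_k^(n)(x) = Σ_{j=0}^k (-1)^j C(x,j) C(n-x, k-j)`. -/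
def kraw (n k : ℕ) (x : ℝ) : ℝ :=
  ∑ j ∈ Finset.range (k + 1), (-1 : ℝ) ^ j * rchoose x j * rchoose ((n : ℝ) - x) (k - j)

/-- `τ(n) = (1/2)(n/2 + 2 − √(n/2+2))`. -/
def tau (n : ℕ) : ℝ := (1 / 2) * ((n : ℝ) / 2 + 2 - Real.sqrt ((n : ℝ) / 2 + 2))

open Polynomial in
/-- `p` is dominated by `q` when `|p_k| ≤ q_k` for all coefficients. -/
def CoeffDominated (p q : ℝ[X]) : Prop := ∀ k, |p.coeff k| ≤ q.coeff k

namespace CoeffDominated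

open Polynomial

variable {p q p' q' : ℝ[X]}

lemma mul (h : CoeffDominated p q) (h' : CoeffDominated p' q') :
    CoeffDominated (p * p') (q * q') := by
  intro k
  rw [coeff_mul, coeff_mul]
  refine (Finset.abs_sum_le_sum_abs _ _).trans (Finset.sum_le_sum fun x _ => ?_)
  rw [abs_mul]
  exact mul_le_mul (h _) (h' _) (abs_nonneg _) ((abs_nonneg _).trans (h _))

lemma one : CoeffDominated 1 1 := by
  intro k
  rw [coeff_one]
  split_ifs <;> simp

lemma pow (h : CoeffDominated p q) (m : ℕ) : CoeffDominated (p ^ m) (q ^ m) := by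
  induction m with
  | zero => simpa using one
  | succ m ih => simpa only [pow_succ] using ih.mul h

lemma one_add_X : CoeffDominated (1 + X) (1 + X) := by
  intro k
  rw [coeff_add, coeff_one, coeff_X]
  split_ifs <;> norm_num

lemma one_sub_X : CoeffDominated (1 - X) (1 + X) := by
  intro k
  rw [coeff_add, coeff_sub, coeff_one, coeff_X]
  split_ifs <;> first | omega | norm_num

lemma one_sub_X_sq : CoeffDominated (1 - X ^ 2) (1 + X ^ 2) := by
  intro k
  rw [coeff_add, coeff_sub, coeff_one, coeff_X_pow]
  split_ifs <;> first | omega | norm_num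

lemma one_sub_X_pow_mul_one_add_X_pow (a b : ℕ) :
    CoeffDominated ((1 - X) ^ (a + 3) * (1 + X) ^ (b + 3))
      ((1 + X ^ 2) ^ 3 * (1 + X) ^ (a + b)) := by
  have h := (one_sub_X_sq.pow 3).mul ((one_sub_X.pow a).mul (one_add_X.pow b))
  convert h using 1 <;> ring

end CoeffDominated

lemma rchoose_natCast (m j : ℕ) : rchoose m j = m.choose j := by
  rw [rchoose, ← descPochhammer_eval_eq_prod_range, descPochhammer_eval_eq_descFactorial,
    Nat.descFactorial_eq_factorial_mul_choose]
  have := Nat.cast_ne_zero (R := ℝ).2 j.factorial_ne_zero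
  push_cast
  field_simp

open Polynomial in
lemma coeff_comp_neg_X (p : ℝ[X]) (k : ℕ) : (p.comp (-X)).coeff k = (-1) ^ k * p.coeff k := by
  have h : (-X : ℝ[X]) = C (-1) * X := by simp
  rw [h, comp_C_mul_X_coeff, mul_comm]

open Polynomial in
lemma coeff_one_sub_X_pow (m j : ℕ) :
    ((1 - X : ℝ[X]) ^ m).coeff j = (-1) ^ j * (m.choose j : ℝ) := by
  have h : (1 - X : ℝ[X]) ^ m = ((1 + X) ^ m).comp (-X) := by simp [sub_eq_add_neg]
  rw [h, coeff_comp_neg_X, coeff_one_add_X_pow]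

open Polynomial in
lemma kraw_add_eq_coeff (a b k : ℕ) :
    kraw (a + b) k a = ((1 - X : ℝ[X]) ^ a * (1 + X) ^ b).coeff k := by
  rw [coeff_mul, Finset.Nat.sum_antidiagonal_eq_sum_range_succ_mk, kraw]
  refine Finset.sum_congr rfl fun j _ => ?_
  have h : (((a + b : ℕ) : ℝ) - a) = (b : ℕ) := by push_cast; ring
  rw [h, rchoose_natCast, rchoose_natCast, coeff_one_sub_X_pow, coeff_one_add_X_pow]

open Polynomial in
lemma kraw_add_symm (a b k : ℕ) : kraw (a + b) k a = (-1) ^ k * kraw (b + a) k b := by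
  have h : (1 - X : ℝ[X]) ^ a * (1 + X) ^ b = ((1 - X : ℝ[X]) ^ b * (1 + X) ^ a).comp (-X) := by
    simp [sub_eq_add_neg, mul_comm]
  rw [kraw_add_eq_coeff, kraw_add_eq_coeff, h, coeff_comp_neg_X]

lemma cast_choose_add_two (m a : ℕ) :
    ((m + 2 : ℝ) * (m + 1)) * m.choose a
      = (a + 1) * (m + 1 - a) * (m + 2).choose (a + 1) := by
  have h₁ : ((m : ℝ) + 2) * (m + 1).choose a = (m + 2).choose (a + 1) * (a + 1) := by
    exact_mod_cast Nat.add_one_mul_choose_eq (m + 1) a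
  have h₂ : ((m + 1).choose a : ℝ) * (m + 1 - a) = m.choose a * (m + 1) := by
    rcases le_or_gt a (m + 1) with ha | ha
    · have h := Nat.choose_mul_succ_eq m a
      have h' : (((m + 1 - a : ℕ)) : ℝ) = m + 1 - a := by push_cast [Nat.cast_sub ha]; ring
      rw [← h']
      exact_mod_cast h.symm
    · rw [Nat.choose_eq_zero_of_lt ha, Nat.choose_eq_zero_of_lt (by omega)]
      simp
  linear_combination (m + 1 - a : ℝ) * h₁ - (m + 2 : ℝ) * h₂

open Polynomial in
lemma one_sub_X_sq_mul_sub (N : ℕ) :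
    (1 - X : ℝ[X]) ^ 2 * (1 + X) ^ (N + 4) - (1 + X ^ 2) ^ 3 * (1 + X) ^ N
      = C 2 * (X * (1 + X) ^ (N + 4)) - C 12 * (X ^ 2 * (1 + X) ^ (N + 2))
        + C 8 * (X ^ 3 * (1 + X) ^ N) := by
  have h₂ : (C 2 : ℝ[X]) = 2 := rfl
  have h₁₂ : (C 12 : ℝ[X]) = 12 := rfl
  have h₈ : (C 8 : ℝ[X]) = 8 := rfl
  rw [h₂, h₁₂, h₈]
  ring

/-- With `M = 2r² - 6`, the quartic controlling `C(M,j) - 6 C(M-2,j-1) + 4 C(M-4,j-2)` is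
nonnegative as long as `1 ≤ j ≤ (r - 2)(r + 1)/2`. -/
lemma quartic_nonneg {r M j : ℝ} (hr : 0 ≤ r) (hM : M = 2 * r ^ 2 - 6) (hj : 1 ≤ j)
    (hjr : 2 * j ≤ (r - 2) * (r + 1)) :
    0 ≤ M * (M - 1) * (M - 2) * (M - 3) - 6 * (j * (M - j)) * ((M - 2) * (M - 3))
      + 4 * (j * (M - j)) * ((j - 1) * (M - j - 1)) := by
  have hr' : 5 / 2 ≤ r := by nlinarith
  obtain ⟨t, ht, rfl⟩ : ∃ t, 0 ≤ t ∧ r = t + 5 / 2 := ⟨r - 5 / 2, by linarith, by ring⟩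
  set j₀ : ℝ := (t + 5 / 2 - 2) * (t + 5 / 2 + 1) / 2 with hj₀
  have hjj : j ≤ j₀ := by linarith
  have hM4 : 6 ≤ M := by nlinarith
  have hj₀M : j₀ ≤ M / 4 := by rw [hj₀, hM]; nlinarith
  set P := j * (M - j) with hP
  set P₀ := j₀ * (M - j₀) with hP₀
  have hPP : P ≤ P₀ := by
    have : 0 ≤ (j₀ - j) * (M - j - j₀) := mul_nonneg (by linarith) (by linarith)
    rw [hP, hP₀]; linarith
  have hP₀M : P₀ ≤ 3 / 16 * M ^ 2 := by
    have : 0 ≤ (M / 4 - j₀) * (3 * M / 4 - j₀) := mul_nonneg (by linarith) (by linarith)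
    rw [hP₀]; linarith
  have hmono : 0 ≤ (P₀ - P) * (6 * (M - 2) * (M - 3) + 4 * (M - 1) - 4 * (P + P₀)) :=
    mul_nonneg (by linarith) (by nlinarith)
  have hend : 0 ≤ M * (M - 1) * (M - 2) * (M - 3) - 6 * P₀ * ((M - 2) * (M - 3))
      + 4 * P₀ * (P₀ - M + 1) := by
    rw [hP₀, hM, hj₀]
    ring_nf
    positivity
  have hq : (j - 1) * (M - j - 1) = P - M + 1 := by rw [hP]; ring
  rw [hq]
  linarith

open Polynomial in
lemma coeff_le_kraw_two {N k : ℕ} (hk : (k : ℝ) ≤ tau (N + 6)) :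
    ((1 + X ^ 2 : ℝ[X]) ^ 3 * (1 + X) ^ N).coeff k ≤ kraw (N + 6) k 2 := by
  have hkr : kraw (N + 6) k 2 = ((1 - X : ℝ[X]) ^ 2 * (1 + X) ^ (N + 4)).coeff k := by
    have := kraw_add_eq_coeff 2 (N + 4) k
    rwa [show 2 + (N + 4) = N + 6 by ring, Nat.cast_ofNat] at this
  rw [hkr, ← sub_nonneg, ← coeff_sub, one_sub_X_sq_mul_sub, coeff_add, coeff_sub,
    coeff_C_mul, coeff_C_mul, coeff_C_mul]
  match k, hk with
  | 0, _ => simp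
  | 1, _ => simp [coeff_X_pow_mul', coeff_X_mul, coeff_one_add_X_pow]
  | j + 2, hk =>
    set r := Real.sqrt (((N + 6 : ℕ) : ℝ) / 2 + 2) with hrdef
    have hr : 0 ≤ r := Real.sqrt_nonneg _
    have hr2 : r ^ 2 = ((N + 6 : ℕ) : ℝ) / 2 + 2 := Real.sq_sqrt (by positivity)
    rw [tau, ← hrdef] at hk
    push_cast at hr2 hk
    have hF := quartic_nonneg (r := r) (M := N + 4) (j := j + 1) hr (by linarith)
      (by linarith [(Nat.cast_nonneg j : (0 : ℝ) ≤ j)]) (by nlinarith)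
    have h₁ := cast_choose_add_two (N + 2) j
    have hc : (X ^ 3 * (1 + X : ℝ[X]) ^ N).coeff (j + 2) * (((N : ℝ) + 2) * (N + 1))
        = (j : ℝ) * (N + 2 - j) * (N + 2).choose j := by
      cases j with
      | zero => simp [coeff_X_pow_mul']
      | succ a =>
        have h := cast_choose_add_two N a
        rw [show a + 1 + 2 = a + 3 by ring, coeff_X_pow_mul, coeff_one_add_X_pow]
        push_cast
        linarith
    rw [show j + 2 = (j + 1) + 1 by ring, coeff_X_mul, coeff_one_add_X_pow,
      show j + 1 + 1 = j + 2 by ring, coeff_X_pow_mul, coeff_one_add_X_pow]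
    push_cast at h₁
    have hC : (0 : ℝ) ≤ (N + 4).choose (j + 1) := Nat.cast_nonneg _
    have hpos : (0 : ℝ) < (N + 4) * (N + 3) * ((N + 2) * (N + 1)) := by positivity
    refine nonneg_of_mul_nonneg_right ?_ hpos
    have := mul_nonneg hC hF
    rw [show N + 2 + 2 = N + 4 by ring] at h₁
    linear_combination 2 * this + (12 * (N + 2) * (N + 1) - 8 * j * (N + 2 - j) : ℝ) * h₁
      - 8 * (N + 4) * (N + 3) * hc

/-- Lemma 1, part 3: for `0 ≤ k ≤ τ(n)` and `2 ≤ i ≤ n−2`,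
`K_k^(n)(2) ≥ |K_k^(n)(i)|`. -/
theorem kraw_two_extremal (n k i : ℕ) (hn : 1 ≤ n) (hk : (k : ℝ) ≤ tau n)
    (hi1 : 2 ≤ i) (hi2 : i ≤ n - 2) :
    |kraw n k (i : ℝ)| ≤ kraw n k 2 := by
  rcases lt_or_ge n 6 with hn6 | hn6
  · have hk1 : k ≤ 1 := by
      have hs : (3 / 2 : ℝ) ≤ Real.sqrt ((n : ℝ) / 2 + 2) := by
        apply Real.le_sqrt_of_sq_le
        have : (1 : ℝ) ≤ n := by exact_mod_cast hn
        linarith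
      have hn5 : (n : ℝ) ≤ 5 := by exact_mod_cast Nat.lt_succ_iff.1 hn6
      rw [tau] at hk
      have : (k : ℝ) < 2 := by linarith
      have : k < 2 := by exact_mod_cast this
      omega
    have hn4 : 4 ≤ n := by omega
    interval_cases n <;> interval_cases k <;> interval_cases i <;>
      norm_num [kraw, rchoose, Finset.sum_range_succ, Finset.prod_range_succ]
  obtain ⟨N, rfl⟩ : ∃ N, n = N + 6 := ⟨n - 6, by omega⟩
  have hle := coeff_le_kraw_two hk
  have hnonneg : 0 ≤ kraw (N + 6) k 2 :=
    (abs_nonneg _).trans ((((CoeffDominated.one_sub_X_sq.pow 3).mul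
      (CoeffDominated.one_add_X.pow N)) k).trans hle)
  rcases hi1.eq_or_lt with rfl | hi1
  · simp [abs_of_nonneg hnonneg]
  rcases hi2.eq_or_lt with rfl | hi2
  · have h := kraw_add_symm (N + 4) 2 k
    rw [show N + 4 + 2 = N + 6 by ring, show 2 + (N + 4) = N + 6 by ring, Nat.cast_ofNat] at h
    rw [show N + 6 - 2 = N + 4 by omega, h, abs_mul]
    simp [abs_of_nonneg hnonneg]
  · obtain ⟨a, rfl⟩ : ∃ a, i = a + 3 := ⟨i - 3, by omega⟩
    obtain ⟨b, rfl⟩ : ∃ b, N = a + b := ⟨N - a, by omega⟩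
    have h := kraw_add_eq_coeff (a + 3) (b + 3) k
    rw [show a + 3 + (b + 3) = a + b + 6 by ring] at h
    rw [h]
    exact (CoeffDominated.one_sub_X_pow_mul_one_add_X_pow a b k).trans hle
end
end

section
/- For every nonnegative integer i and every δ with 0 < δ < 1/2, there exists N such that for all n ≥ N, all integers k with δn ≤ k ≤ (1/2 − δ)n, and all real x with i ≤ x ≤ n − i, one has K_k^(n)(i) ≥ |K_k^(n)(x)|. -/
noncomputable section

/-- The binomial series `∑ C(x, j) X ^ j = (1 + X) ^ x`. -/
def binomSeries (x : ℝ) : PowerSeries ℝ := PowerSeries.mk (rchoose x)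

/-- The series `(1 - X) ^ x * (1 + X) ^ (n - x)` generating the Krawtchouk polynomials. -/
def krawSeries (n : ℕ) (x : ℝ) : PowerSeries ℝ :=
  PowerSeries.rescale (-1) (binomSeries x) * binomSeries (n - x)

/-- The series `∑ (-1) ^ (m - 1) X ^ m / m = log (1 + X)`. -/
def logSeries : PowerSeries ℝ := PowerSeries.mk fun m => -(-1) ^ m / m

theorem rchoose_zero (x : ℝ) : rchoose x 0 = 1 := by simp [rchoose]

theorem rchoose_succ_mul (x : ℝ) (j : ℕ) :
    rchoose x (j + 1) * (j + 1) = rchoose x j * (x - j) := by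
  have h : ((j.factorial : ℕ) : ℝ) ≠ 0 := by positivity
  simp only [rchoose, Finset.prod_range_succ, Nat.factorial_succ, Nat.cast_mul]
  push_cast
  field_simp

theorem rchoose_succ_mul' (x : ℝ) (j : ℕ) :
    rchoose x (j + 1) * (j + 1) = x * rchoose (x - 1) j := by
  have h : ((j.factorial : ℕ) : ℝ) ≠ 0 := by positivity
  have hp : ∏ i ∈ Finset.range j, (x - ((i + 1 : ℕ) : ℝ)) =
      ∏ i ∈ Finset.range j, (x - 1 - i) :=
    Finset.prod_congr rfl fun i _ => by push_cast; ring
  simp only [rchoose, Finset.prod_range_succ', Nat.factorial_succ, Nat.cast_mul, hp]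
  push_cast
  field_simp
  ring

theorem rchoose_succ_eq_add (x : ℝ) (j : ℕ) :
    rchoose x (j + 1) = rchoose (x - 1) (j + 1) + rchoose (x - 1) j := by
  have h : ((j : ℝ) + 1) ≠ 0 := by positivity
  apply mul_right_cancel₀ h
  rw [add_mul, rchoose_succ_mul', rchoose_succ_mul]
  ring

theorem rchoose_natCast_s13 (n j : ℕ) : rchoose n j = n.choose j := by
  have h : ((j.factorial : ℕ) : ℝ) ≠ 0 := by positivity
  rw [rchoose, div_eq_iff h, ← Nat.cast_mul, mul_comm, ← Nat.descFactorial_eq_factorial_mul_choose,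
    Nat.descFactorial_eq_prod_range]
  by_cases hj : j ≤ n
  · push_cast
    refine Finset.prod_congr rfl fun i hi => ?_
    rw [Nat.cast_sub (by have := Finset.mem_range.1 hi; omega)]
  · push Not at hj
    rw [Finset.prod_eq_zero (Finset.mem_range.2 hj) (sub_self _),
      Finset.prod_eq_zero (Finset.mem_range.2 hj) (Nat.sub_self _), Nat.cast_zero]

theorem coeff_krawSeries (n k : ℕ) (x : ℝ) :
    PowerSeries.coeff k (krawSeries n x) = kraw n k x := by
  simp [krawSeries, kraw, PowerSeries.coeff_mul, Finset.Nat.sum_antidiagonal_eq_sum_range_succ_mk,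
    binomSeries]

theorem derivative_binomSeries (x : ℝ) :
    PowerSeries.derivative (R := ℝ) (binomSeries x) = PowerSeries.C x * binomSeries (x - 1) := by
  ext j
  simp [PowerSeries.coeff_derivative, binomSeries, rchoose_succ_mul']

theorem binomSeries_eq_mul (x : ℝ) :
    binomSeries x = (1 + PowerSeries.X) * binomSeries (x - 1) := by
  ext j
  rw [add_mul, one_mul, map_add]
  cases j with
  | zero => simp [binomSeries, rchoose_zero]
  | succ j => rw [PowerSeries.coeff_succ_X_mul]; simp [binomSeries, rchoose_succ_eq_add x j]

theorem derivative_rescale_neg_one (f : PowerSeries ℝ) :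
    PowerSeries.derivative (R := ℝ) (PowerSeries.rescale (-1) f) =
      -PowerSeries.rescale (-1) (PowerSeries.derivative (R := ℝ) f) := by
  ext j
  simp [PowerSeries.coeff_derivative, pow_succ]
  ring

theorem rescale_X_neg_one :
    PowerSeries.rescale (-1 : ℝ) PowerSeries.X = -PowerSeries.X := by
  ext j
  simp [PowerSeries.coeff_X]

theorem rescale_C_neg_one (x : ℝ) :
    PowerSeries.rescale (-1 : ℝ) (PowerSeries.C x) = PowerSeries.C x := by
  ext j
  rcases eq_or_ne j 0 with rfl | h <;> simp [PowerSeries.coeff_C, *]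

theorem kraw_recurrence (n k : ℕ) (x : ℝ) :
    (n - x) * kraw n k (x + 1) = (n - 2 * k) * kraw n k x - x * kraw n k (x - 1) := by
  have key : PowerSeries.C (n - x) * krawSeries n (x + 1) - PowerSeries.C (n : ℝ) * krawSeries n x
      + 2 * (PowerSeries.X * PowerSeries.derivative (R := ℝ) (krawSeries n x))
      + PowerSeries.C x * krawSeries n (x - 1) = 0 := by
    have h1 := binomSeries_eq_mul (x + 1)
    have h2 := binomSeries_eq_mul x
    have h3 := binomSeries_eq_mul (n - (x - 1))
    have h4 := binomSeries_eq_mul (n - x)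
    rw [show x + 1 - 1 = x by ring] at h1
    rw [show (n : ℝ) - (x - 1) - 1 = n - x by ring] at h3
    simp only [krawSeries, Derivation.leibniz, smul_eq_mul, derivative_rescale_neg_one,
      derivative_binomSeries, map_mul, rescale_C_neg_one]
    rw [show (n : ℝ) - (x + 1) = n - x - 1 by ring, h3, h4, h1, h2]
    simp only [map_mul, map_add, map_one, rescale_X_neg_one, map_sub]
    ring
  have hc := congrArg (PowerSeries.coeff k) key
  have hX : PowerSeries.coeff k (PowerSeries.X * PowerSeries.derivative (R := ℝ) (krawSeries n x))
      = k * kraw n k x := by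
    cases k with
    | zero => simp
    | succ k =>
      rw [PowerSeries.coeff_succ_X_mul, PowerSeries.coeff_derivative, coeff_krawSeries]
      push_cast
      ring
  have h2 : (2 : PowerSeries ℝ) = PowerSeries.C 2 := (map_ofNat PowerSeries.C 2).symm
  rw [h2] at hc
  simp only [map_add, map_sub, sub_mul, map_zero, PowerSeries.coeff_C_mul, coeff_krawSeries, hX]
    at hc
  linear_combination hc

theorem kraw_reflect (n k : ℕ) (x : ℝ) : kraw n k (n - x) = (-1) ^ k * kraw n k x := by
  rw [kraw, kraw, ← Finset.sum_range_reflect, Finset.mul_sum]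
  refine Finset.sum_congr rfl fun j hj => ?_
  have hj' : j ≤ k := Nat.lt_succ_iff.1 (Finset.mem_range.1 hj)
  obtain ⟨m, rfl⟩ := Nat.exists_eq_add_of_le hj'
  have e : j + m + 1 - 1 - j = m := by omega
  have hs : ((-1 : ℝ)) ^ j * (-1) ^ j = 1 := by rw [← mul_pow]; simp
  rw [e, Nat.add_sub_cancel, Nat.add_sub_cancel_left, sub_sub_cancel, pow_add]
  linear_combination (-(-1 : ℝ) ^ m * rchoose x j * rchoose (n - x) m) * hs

theorem kraw_zero_right (n k : ℕ) : kraw n k 0 = n.choose k := by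
  rw [kraw, Finset.sum_eq_single 0]
  · simp [rchoose_zero, rchoose_natCast_s13]
  · intro j _ hj
    have : rchoose 0 j = 0 := by
      rw [rchoose, Finset.prod_eq_zero (Finset.mem_range.2 (Nat.pos_of_ne_zero hj)) (by simp),
        zero_div]
    simp [this]
  · simp

theorem hasDerivAt_rchoose (j : ℕ) (x : ℝ) :
    HasDerivAt (fun y => rchoose y j) (PowerSeries.coeff j (logSeries * binomSeries x)) x := by
  have hlog : (1 + PowerSeries.X) * PowerSeries.derivative (R := ℝ) logSeries = 1 := by
    ext m
    rw [add_mul, one_mul, map_add]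
    cases m with
    | zero => simp [logSeries, PowerSeries.coeff_derivative]
    | succ m =>
      rw [PowerSeries.coeff_succ_X_mul]
      simp only [logSeries, PowerSeries.coeff_derivative, PowerSeries.coeff_mk,
        PowerSeries.coeff_one]
      push_cast
      field_simp
      simp [pow_succ]
  have hode : (1 + PowerSeries.X) * PowerSeries.derivative (R := ℝ) (logSeries * binomSeries x) =
      binomSeries x + PowerSeries.C x * (logSeries * binomSeries x) := by
    simp only [Derivation.leibniz, smul_eq_mul, derivative_binomSeries]
    conv_rhs => rw [binomSeries_eq_mul]
    rw [binomSeries_eq_mul x]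
    linear_combination ((1 + PowerSeries.X) * binomSeries (x - 1)) * hlog
  have hrec (j : ℕ) : PowerSeries.coeff (j + 1) (logSeries * binomSeries x) * (j + 1) =
      rchoose x j + (x - j) * PowerSeries.coeff j (logSeries * binomSeries x) := by
    have hc := congrArg (PowerSeries.coeff j) hode
    rw [add_mul, one_mul, map_add, map_add, PowerSeries.coeff_C_mul,
      PowerSeries.coeff_derivative, binomSeries, PowerSeries.coeff_mk] at hc
    rw [binomSeries]
    cases j with
    | zero => simpa using hc
    | succ j =>
      rw [PowerSeries.coeff_succ_X_mul, PowerSeries.coeff_derivative] at hc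
      push_cast at hc ⊢
      linear_combination hc
  induction j with
  | zero =>
    simp only [rchoose_zero]
    simpa [PowerSeries.coeff_mul, logSeries] using hasDerivAt_const x (1 : ℝ)
  | succ j ih =>
    have h : ((j : ℝ) + 1) ≠ 0 := by positivity
    have h1 := (ih.mul ((hasDerivAt_id x).sub_const (j : ℝ))).div_const ((j : ℝ) + 1)
    convert! h1 using 1
    · ext y
      simp [eq_div_iff h, rchoose_succ_mul]
    · rw [eq_div_iff h, hrec]
      simp
      ring

theorem hasDerivAt_kraw (n k : ℕ) (x : ℝ) :
    HasDerivAt (kraw n k)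
      (PowerSeries.coeff k
        ((PowerSeries.rescale (-1) logSeries - logSeries) * krawSeries n x)) x := by
  have h : HasDerivAt (kraw n k) (∑ j ∈ Finset.range (k + 1),
      ((-1) ^ j * PowerSeries.coeff j (logSeries * binomSeries x) * rchoose (n - x) (k - j) +
        (-1) ^ j * rchoose x j *
          (PowerSeries.coeff (k - j) (logSeries * binomSeries (n - x)) * (-1)))) x := by
    refine HasDerivAt.fun_sum fun j _ => ?_
    refine HasDerivAt.mul ((hasDerivAt_rchoose j x).const_mul _) ?_
    exact (hasDerivAt_rchoose (k - j) (n - x)).comp x ((hasDerivAt_id x).const_sub (n : ℝ))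
  convert h using 1
  have e : (PowerSeries.rescale (-1) logSeries - logSeries) * krawSeries n x =
      PowerSeries.rescale (-1) (logSeries * binomSeries x) * binomSeries (n - x) -
      PowerSeries.rescale (-1) (binomSeries x) * (logSeries * binomSeries (n - x)) := by
    rw [krawSeries, map_mul]
    ring
  rw [e, map_sub, PowerSeries.coeff_mul, PowerSeries.coeff_mul,
    Finset.Nat.sum_antidiagonal_eq_sum_range_succ_mk,
    Finset.Nat.sum_antidiagonal_eq_sum_range_succ_mk, ← Finset.sum_sub_distrib]
  refine Finset.sum_congr rfl fun j _ => ?_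
  simp only [PowerSeries.coeff_rescale]
  simp only [binomSeries, PowerSeries.coeff_mk]
  ring

theorem deriv_kraw_nonpos {n k : ℕ} {x : ℝ} (h : ∀ l < k, 0 ≤ kraw n l x) :
    deriv (kraw n k) x ≤ 0 := by
  rw [(hasDerivAt_kraw n k x).deriv, PowerSeries.coeff_mul]
  refine Finset.sum_nonpos fun p hp => ?_
  rw [coeff_krawSeries]
  have hp' := Finset.HasAntidiagonal.mem_antidiagonal.1 hp
  rcases Nat.eq_zero_or_pos p.1 with h0 | h0
  · simp only [h0, map_sub, PowerSeries.coeff_rescale, logSeries, PowerSeries.coeff_mk]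
    simp
  · refine mul_nonpos_of_nonpos_of_nonneg ?_ (h _ (by omega))
    simp only [map_sub, PowerSeries.coeff_rescale, logSeries, PowerSeries.coeff_mk]
    have hs : ((-1 : ℝ)) ^ p.1 * (-1) ^ p.1 = 1 := by rw [← mul_pow]; simp
    have h1 : (-1 : ℝ) ^ p.1 ≤ 1 := by
      rcases neg_one_pow_eq_or ℝ p.1 with h | h <;> norm_num [h]
    rw [← mul_div_assoc, ← sub_div]
    exact div_nonpos_of_nonpos_of_nonneg (by nlinarith) (by positivity)

theorem kraw_natCast_pos {δ : ℝ} (hδ : 0 < δ) {n l : ℕ} (hn : 0 < n)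
    (hl : (l : ℝ) ≤ (1 / 2 - δ) * n) {m : ℕ} (hm : (m : ℝ) ≤ δ ^ 2 * n) :
    0 < kraw n l m ∧ δ * kraw n l m ≤ kraw n l (m + 1) := by
  have hn' : (0 : ℝ) < n := by exact_mod_cast hn
  have hδ2 : δ ≤ 1 / 2 := by
    by_contra! h
    nlinarith [Nat.cast_nonneg (α := ℝ) l]
  induction m with
  | zero =>
    have hln : l ≤ n := by
      have : (l : ℝ) ≤ n := by nlinarith
      exact_mod_cast this
    have h0 : (0 : ℝ) < n.choose l := by exact_mod_cast Nat.choose_pos hln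
    have hr := kraw_recurrence n l 0
    rw [sub_zero, zero_mul, sub_zero, kraw_zero_right] at hr
    rw [Nat.cast_zero, kraw_zero_right]
    refine ⟨h0, le_of_mul_le_mul_left ?_ hn'⟩
    rw [hr, ← mul_assoc]
    exact mul_le_mul_of_nonneg_right (by nlinarith) h0.le
  | succ m ih =>
    push_cast at hm ⊢
    obtain ⟨h0, h1⟩ := ih (by linarith)
    have hpos : 0 < kraw n l (m + 1) := lt_of_lt_of_le (by positivity) h1
    refine ⟨hpos, ?_⟩
    have hr := kraw_recurrence n l (m + 1)
    rw [add_sub_cancel_right] at hr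
    have hm1 : (0 : ℝ) < n - (m + 1) := by nlinarith
    refine le_of_mul_le_mul_left ?_ hm1
    rw [hr]
    have h2 : (m + 1) * kraw n l m ≤ δ * n * kraw n l (m + 1) := by
      calc (m + 1) * kraw n l m ≤ δ ^ 2 * n * kraw n l m := by gcongr
        _ = δ * n * (δ * kraw n l m) := by ring
        _ ≤ δ * n * kraw n l (m + 1) := by gcongr
    have h3 : 2 * δ * n * kraw n l (m + 1) ≤ (n - 2 * l) * kraw n l (m + 1) :=
      mul_le_mul_of_nonneg_right (by linarith) hpos.le
    have h4 : 0 ≤ (m + 1) * δ * kraw n l (m + 1) := by positivity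
    linarith

theorem pow_mul_choose_le_kraw {δ : ℝ} (hδ : 0 < δ) {n l : ℕ} (hn : 0 < n)
    (hl : (l : ℝ) ≤ (1 / 2 - δ) * n) {m : ℕ} (hm : (m : ℝ) ≤ δ ^ 2 * n) :
    δ ^ m * n.choose l ≤ kraw n l m := by
  induction m with
  | zero => simp [kraw_zero_right]
  | succ m ih =>
    push_cast at hm ⊢
    have hm' : (m : ℝ) ≤ δ ^ 2 * n := by linarith
    calc δ ^ (m + 1) * n.choose l = δ * (δ ^ m * n.choose l) := by ring
      _ ≤ δ * kraw n l m := by gcongr; exact ih hm'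
      _ ≤ _ := (kraw_natCast_pos hδ hn hl hm').2

theorem kraw_antitoneOn {δ : ℝ} (hδ : 0 < δ) {n l : ℕ} (hn : 0 < n)
    (hl : (l : ℝ) ≤ (1 / 2 - δ) * n) {m : ℕ} (hm : (m : ℝ) ≤ δ ^ 2 * n) :
    AntitoneOn (kraw n l) (Set.Icc 0 m) := by
  induction l using Nat.strong_induction_on with
  | _ l ih =>
  refine antitoneOn_of_deriv_nonpos (convex_Icc _ _)
    (fun x _ => (hasDerivAt_kraw n l x).continuousAt.continuousWithinAt)
    (fun x _ => (hasDerivAt_kraw n l x).differentiableAt.differentiableWithinAt) ?_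
  intro x hx
  rw [interior_Icc] at hx
  refine deriv_kraw_nonpos fun j hj => ?_
  have hj' : (j : ℝ) ≤ (1 / 2 - δ) * n := le_trans (by exact_mod_cast hj.le) hl
  exact (kraw_natCast_pos hδ hn hj' hm).1.le.trans
    (ih j hj hj' ⟨hx.1.le, hx.2.le⟩ ⟨Nat.cast_nonneg m, le_rfl⟩ hx.2.le)

theorem abs_kraw_le_of_le_succ {δ : ℝ} (hδ : 0 < δ) {n k i : ℕ} (hn : 0 < n)
    (hk : (k : ℝ) ≤ (1 / 2 - δ) * n) (hi : ((i + 2 : ℕ) : ℝ) ≤ δ ^ 2 * n)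
    {x : ℝ} (hix : i ≤ x) (hxk : x ≤ k + 1) : |kraw n k x| ≤ kraw n k i := by
  have hn' : (0 : ℝ) < n := by exact_mod_cast hn
  have hanti := kraw_antitoneOn hδ hn hk hi
  have hi0 : (0 : ℝ) ≤ i := Nat.cast_nonneg i
  have hpos := (kraw_natCast_pos hδ hn hk hi).1.le
  push_cast at hanti hpos
  have base (y : ℝ) (hy : i ≤ y) (hy' : y ≤ i + 2) : |kraw n k y| ≤ kraw n k i := by
    have hmem : y ∈ Set.Icc (0 : ℝ) (i + 2) := ⟨hi0.trans hy, hy'⟩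
    rw [abs_of_nonneg (hpos.trans (hanti hmem ⟨by linarith, le_rfl⟩ hy'))]
    exact hanti ⟨hi0, by linarith⟩ hmem hy
  have main (y : ℝ) (hy : i ≤ y) (hy' : y ≤ i + 1) (j : ℕ) (hj : y + j ≤ k) :
      |kraw n k (y + j)| ≤ kraw n k i ∧ |kraw n k (y + j + 1)| ≤ kraw n k i := by
    induction j with
    | zero =>
      rw [Nat.cast_zero, add_zero]
      exact ⟨base y hy (by linarith), base _ (by linarith) (by linarith)⟩
    | succ j ih =>
      push_cast at hj ⊢
      obtain ⟨h0, h1⟩ := ih (by linarith)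
      rw [← add_assoc] at hj ⊢
      refine ⟨h1, ?_⟩
      have hr := kraw_recurrence n k (y + j + 1)
      rw [add_sub_cancel_right] at hr
      set z := y + j + 1 with hz
      have hz0 : 0 ≤ z := by have := hi0.trans hy; positivity
      have hnz : (0 : ℝ) < n - z := by nlinarith
      have h2k : (0 : ℝ) ≤ n - 2 * k := by nlinarith
      refine le_of_mul_le_mul_left ?_ hnz
      calc (n - z) * |kraw n k (z + 1)| = |(n - z) * kraw n k (z + 1)| := by
            rw [abs_mul, abs_of_pos hnz]
        _ ≤ |(n - 2 * k) * kraw n k z| + |z * kraw n k (y + j)| := by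
            rw [hr]; exact abs_sub _ _
        _ = (n - 2 * k) * |kraw n k z| + z * |kraw n k (y + j)| := by
            rw [abs_mul, abs_mul, abs_of_nonneg h2k, abs_of_nonneg hz0]
        _ ≤ (n - 2 * k) * kraw n k i + z * kraw n k i := by gcongr
        _ = (n - 2 * k + z) * kraw n k i := by ring
        _ ≤ (n - z) * kraw n k i :=
            mul_le_mul_of_nonneg_right (by linarith) ((abs_nonneg _).trans h0)
  by_cases hx : x ≤ i + 2
  · exact base x hix hx
  · push Not at hx
    have hf := Nat.floor_le (sub_nonneg.2 hix)
    have hf' := Nat.lt_floor_add_one (x - i)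
    obtain ⟨j, hj⟩ : ∃ j, ⌊x - i⌋₊ = j + 1 :=
      Nat.exists_eq_add_one.2 (Nat.floor_pos.2 (by linarith))
    rw [hj] at hf hf'
    push_cast at hf hf'
    have h := (main (x - (j + 1)) (by linarith) (by linarith) j (by linarith)).2
    rwa [show x - (j + 1) + j + 1 = x by ring] at h

theorem one_add_pow_le_mul_choose {n k : ℕ} (hk : k < n) {r : ℝ}
    (hr : r = k / (n - k)) : (1 + r) ^ n ≤ (n + 1) * (n.choose k * r ^ k) := by
  have hnk : (0 : ℝ) < n - k := sub_pos.2 (by exact_mod_cast hk)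
  have hr0 : 0 ≤ r := by rw [hr]; positivity
  have hrn : r * (n - k) = k := by rw [hr]; field_simp
  have hsucc (j : ℕ) (hj : j ≤ n) :
      (n.choose (j + 1) : ℝ) * r ^ (j + 1) * ((j + 1) * (n - k)) =
        n.choose j * r ^ j * ((n - j) * k) := by
    have h : (n.choose (j + 1) : ℝ) * (j + 1) = n.choose j * (n - j) := by
      rw [← Nat.cast_sub hj]
      exact_mod_cast Nat.choose_succ_right_eq n j
    rw [pow_succ]
    linear_combination (r ^ j * r * (n - k)) * h + (n.choose j * (n - j) * r ^ j) * hrn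
  have hup (j : ℕ) (hj : j < k) :
      (n.choose j : ℝ) * r ^ j ≤ n.choose (j + 1) * r ^ (j + 1) := by
    have hj' : (j : ℝ) + 1 ≤ k := by exact_mod_cast hj
    have hc : (0 : ℝ) < (j + 1) * (n - k) := by positivity
    refine le_of_mul_le_mul_right ?_ hc
    rw [hsucc j (by omega)]
    refine mul_le_mul_of_nonneg_left ?_ (by positivity)
    nlinarith
  have hdown (j : ℕ) (hj : k ≤ j) :
      (n.choose (j + 1) : ℝ) * r ^ (j + 1) ≤ n.choose j * r ^ j := by
    by_cases hjn : j ≤ n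
    · have hj' : (k : ℝ) ≤ j := by exact_mod_cast hj
      have hc : (0 : ℝ) < (j + 1) * (n - k) := by positivity
      refine le_of_mul_le_mul_right ?_ hc
      rw [hsucc j hjn]
      refine mul_le_mul_of_nonneg_left ?_ (by positivity)
      nlinarith
    · rw [Nat.choose_eq_zero_of_lt (by omega)]
      simp only [Nat.cast_zero, zero_mul]
      positivity
  have hmax (j : ℕ) : (n.choose j : ℝ) * r ^ j ≤ n.choose k * r ^ k := by
    rcases le_total j k with h | h
    · refine Nat.decreasingInduction' (P := fun j => (n.choose j : ℝ) * r ^ j ≤ _)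
        (fun m hm _ ih => (hup m hm).trans ih) h le_rfl
    · induction j, h using Nat.le_induction with
      | base => exact le_rfl
      | succ j hj ih => exact (hdown j hj).trans ih
  calc (1 + r) ^ n = ∑ j ∈ Finset.range (n + 1), (n.choose j : ℝ) * r ^ j := by
        rw [add_comm, add_pow]
        exact Finset.sum_congr rfl fun j _ => by rw [one_pow]; ring
    _ ≤ ∑ j ∈ Finset.range (n + 1), (n.choose k : ℝ) * r ^ k :=
        Finset.sum_le_sum fun j _ => hmax j
    _ = _ := by simp

theorem iteratedDeriv_one_add_cpow (a : ℂ) (j : ℕ) {z : ℂ} (hz : ‖z‖ < 1) :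
    iteratedDeriv j (fun w : ℂ => (1 + w) ^ a) z =
      (∏ i ∈ Finset.range j, (a - i)) * (1 + z) ^ (a - j) := by
  induction j generalizing z with
  | zero => simp
  | succ j ih =>
    have hev : iteratedDeriv j (fun w : ℂ => (1 + w) ^ a) =ᶠ[nhds z]
        fun w => (∏ i ∈ Finset.range j, (a - i)) * (1 + w) ^ (a - j) := by
      filter_upwards [(continuous_norm.tendsto z).eventually_lt_const hz] with w hw using ih hw
    have hd : HasDerivAt (fun w : ℂ => (1 + w) ^ (a - j)) ((a - j) * (1 + z) ^ (a - j - 1) * 1) z :=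
      ((hasDerivAt_id z).const_add 1).cpow_const (Complex.mem_slitPlane_of_norm_lt_one hz)
    rw [iteratedDeriv_succ, hev.deriv_eq, (hd.const_mul _).deriv, Finset.prod_range_succ]
    push_cast
    rw [show a - (j + 1) = a - j - 1 by ring]
    ring

theorem iteratedDeriv_one_add_cpow_zero (x : ℝ) (j : ℕ) :
    iteratedDeriv j (fun w : ℂ => (1 + w) ^ (x : ℂ)) 0 = j.factorial * (rchoose x j : ℂ) := by
  have h : ((j.factorial : ℕ) : ℂ) ≠ 0 := by exact_mod_cast j.factorial_ne_zero
  rw [iteratedDeriv_one_add_cpow _ _ (by simp), rchoose]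
  push_cast
  rw [mul_div_cancel₀ _ h]
  simp

theorem iteratedDeriv_krawFun (n k : ℕ) (x : ℝ) :
    iteratedDeriv k (fun w : ℂ => (1 + -w) ^ (x : ℂ) * (1 + w) ^ ((n - x : ℝ) : ℂ)) 0 =
      k.factorial * (kraw n k x : ℂ) := by
  have hadd (a : ℂ) : ContDiffAt ℂ k (fun w : ℂ => (1 + w) ^ a) 0 :=
    (Complex.one_add_cpow_hasFPowerSeriesAt_zero.analyticAt).contDiffAt
  have hneg (a : ℂ) : ContDiffAt ℂ k (fun w : ℂ => (1 + -w) ^ a) 0 :=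
    ContDiffAt.comp (0 : ℂ) (f := fun w : ℂ => -w) (g := fun w : ℂ => (1 + w) ^ a)
      (by simpa using hadd a) contDiffAt_id.neg
  rw [iteratedDeriv_fun_mul (hneg _) (hadd _), kraw]
  push_cast
  rw [Finset.mul_sum]
  refine Finset.sum_congr rfl fun j hj => ?_
  rw [iteratedDeriv_comp_neg j (fun w : ℂ => (1 + w) ^ (x : ℂ)), neg_zero,
    iteratedDeriv_one_add_cpow_zero, ← Complex.ofReal_natCast n, ← Complex.ofReal_sub,
    iteratedDeriv_one_add_cpow_zero,
    ← Nat.choose_mul_factorial_mul_factorial (Nat.lt_succ_iff.1 (Finset.mem_range.1 hj))]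
  push_cast
  simp only [smul_eq_mul]
  ring

theorem abs_kraw_le_rpow_div_pow {n k : ℕ} (hn : 0 < n) {x r : ℝ} (hx : 0 ≤ x) (hxn : 2 * x ≤ n)
    (hr : 0 < r) (hr1 : r < 1) :
    |kraw n k x| ≤ ((1 + r) ^ 2 - 4 * r * (x / n)) ^ ((n : ℝ) / 2) / r ^ k := by
  have hn' : (0 : ℝ) < n := by exact_mod_cast hn
  have hbound (z : ℂ) (hz : z ∈ Metric.sphere (0 : ℂ) r) :
      ‖(1 + -z) ^ (x : ℂ) * (1 + z) ^ ((n - x : ℝ) : ℂ)‖ ≤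
        ((1 + r) ^ 2 - 4 * r * (x / n)) ^ ((n : ℝ) / 2) := by
    have hz' : ‖z‖ = r := by simpa using hz
    have hsq : z.re ^ 2 + z.im ^ 2 = r ^ 2 := by
      rw [← hz', Complex.sq_norm, Complex.normSq_apply]; ring
    have hre : z.re ≤ r := hz' ▸ Complex.re_le_norm z
    have hs : ‖1 + -z‖ ^ 2 = 1 + r ^ 2 - 2 * z.re := by
      rw [Complex.sq_norm, Complex.normSq_apply]; simp; linear_combination hsq
    have ht : ‖1 + z‖ ^ 2 = 1 + r ^ 2 + 2 * z.re := by
      rw [Complex.sq_norm, Complex.normSq_apply]; simp; linear_combination hsq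
    have hamgm := Real.geom_mean_le_arith_mean2_weighted (w₁ := x / n) (w₂ := (n - x) / n)
      (by positivity) (div_nonneg (by linarith) hn'.le) (sq_nonneg ‖1 + -z‖) (sq_nonneg ‖1 + z‖)
      (by field_simp; ring)
    have hlin : x / n * ‖1 + -z‖ ^ 2 + (n - x) / n * ‖1 + z‖ ^ 2 ≤
        (1 + r) ^ 2 - 4 * r * (x / n) := by
      have hw : (n - x) / n = 1 - x / n := by field_simp
      have hp : x / n ≤ 1 / 2 := by rw [div_le_iff₀ hn']; linarith
      rw [hs, ht, hw]
      nlinarith [mul_nonneg (sub_nonneg.2 hre) (sub_nonneg.2 hp)]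
    have hpow (s y : ℝ) (hs : 0 ≤ s) : ((s ^ 2) ^ (y / n)) ^ ((n : ℝ) / 2) = s ^ y := by
      rw [← Real.rpow_natCast s 2, ← Real.rpow_mul hs, ← Real.rpow_mul hs]
      congr 1
      push_cast
      field_simp
    rw [norm_mul, Complex.norm_cpow_real, Complex.norm_cpow_real,
      ← hpow _ x (norm_nonneg _), ← hpow _ (n - x) (norm_nonneg _),
      ← Real.mul_rpow (by positivity) (by positivity)]
    exact Real.rpow_le_rpow (by positivity) (hamgm.trans hlin) (by positivity)
  have hdiff : DiffContOnCl ℂ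
      (fun w : ℂ => (1 + -w) ^ (x : ℂ) * (1 + w) ^ ((n - x : ℝ) : ℂ)) (Metric.ball 0 r) := by
    refine DifferentiableOn.diffContOnCl fun w hw => ?_
    have hw' : ‖w‖ < 1 := by
      have := Metric.closure_ball_subset_closedBall hw
      rw [mem_closedBall_zero_iff] at this
      linarith
    refine DifferentiableAt.differentiableWithinAt (DifferentiableAt.mul ?_ ?_)
    · exact (differentiableAt_id.neg.const_add 1).cpow_const
        (Complex.mem_slitPlane_of_norm_lt_one (by simpa using hw'))
    · exact (differentiableAt_id.const_add 1).cpow_const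
        (Complex.mem_slitPlane_of_norm_lt_one hw')
  have h := Complex.norm_iteratedDeriv_le_of_forall_mem_sphere_norm_le k hr hdiff hbound
  rw [iteratedDeriv_krawFun, norm_mul, Complex.norm_natCast, Complex.norm_real, Real.norm_eq_abs,
    mul_div_assoc] at h
  exact le_of_mul_le_mul_left h (by positivity)

theorem abs_kraw_le_mul_choose {n k : ℕ} (hk : 0 < k) (hkn : 2 * k < n) {x : ℝ} (hkx : k ≤ x)
    (hxn : 2 * x ≤ n) :
    |kraw n k x| ≤ (n + 1) * Real.exp (-(k / n) ^ 2 * n) * n.choose k := by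
  have hk' : (0 : ℝ) < k := by exact_mod_cast hk
  have hkn' : (2 : ℝ) * k < n := by exact_mod_cast hkn
  have hn' : (0 : ℝ) < n := by linarith
  have hnk : (0 : ℝ) < n - k := by linarith
  obtain ⟨r, hr⟩ : ∃ r : ℝ, r = k / (n - k) := ⟨_, rfl⟩
  obtain ⟨p, hp⟩ : ∃ p : ℝ, p = k / n := ⟨_, rfl⟩
  have hr0 : 0 < r := by rw [hr]; positivity
  have hr1 : r < 1 := by rw [hr, div_lt_one hnk]; linarith
  have hp0 : 0 < p := by rw [hp]; positivity
  have hp1 : p ≤ 1 / 2 := by rw [hp, div_le_iff₀ hn']; linarith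
  have hrp : r = p * (1 - p) * (1 + r) ^ 2 := by
    rw [hr, hp]; field_simp; ring
  have hpx : p ≤ x / n := by rw [hp]; gcongr
  have hbase : (1 + r) ^ 2 - 4 * r * (x / n) ≤ ((1 + r) * Real.exp (-p ^ 2)) ^ 2 := by
    have he : -2 * p ^ 2 + 1 ≤ Real.exp (-p ^ 2) ^ 2 := by
      rw [← Real.exp_nat_mul]
      have := Real.add_one_le_exp ((2 : ℕ) * -p ^ 2)
      push_cast at this ⊢
      linarith
    have h1 : 4 * r * p ≤ 4 * r * (x / n) := by gcongr
    have h2 : 2 * p ^ 2 * (1 + r) ^ 2 ≤ 4 * r * p := by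
      have : 0 ≤ p ^ 2 * (1 + r) ^ 2 * (1 - 2 * p) :=
        mul_nonneg (by positivity) (by linarith)
      have e : 4 * r * p = 4 * (p * (1 - p) * (1 + r) ^ 2) * p := by rw [← hrp]
      rw [e]
      linarith
    have h3 := mul_le_mul_of_nonneg_left he (sq_nonneg (1 + r))
    rw [mul_pow]
    linarith
  have hnonneg : 0 ≤ (1 + r) ^ 2 - 4 * r * (x / n) := by
    have : x / n ≤ 1 / 2 := by rw [div_le_iff₀ hn']; linarith
    nlinarith [sq_nonneg (1 - r)]
  calc |kraw n k x| ≤ ((1 + r) ^ 2 - 4 * r * (x / n)) ^ ((n : ℝ) / 2) / r ^ k :=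
        abs_kraw_le_rpow_div_pow (by omega) (hk'.le.trans hkx) hxn hr0 hr1
    _ ≤ (((1 + r) * Real.exp (-p ^ 2)) ^ 2) ^ ((n : ℝ) / 2) / r ^ k := by gcongr
    _ = (1 + r) ^ n * Real.exp (-p ^ 2 * n) / r ^ k := by
        rw [← Real.rpow_natCast _ 2, ← Real.rpow_mul (by positivity)]
        rw [show ((2 : ℕ) : ℝ) * (n / 2) = n by push_cast; ring, Real.rpow_natCast, mul_pow,
          ← Real.exp_nat_mul, mul_comm (n : ℝ)]
    _ ≤ (n + 1) * (n.choose k * r ^ k) * Real.exp (-p ^ 2 * n) / r ^ k := by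
        gcongr
        exact one_add_pow_le_mul_choose (by omega) hr
    _ = _ := by rw [← hp]; field_simp

theorem eventually_succ_mul_exp_le {c ε : ℝ} (hc : 0 < c) (hε : 0 < ε) :
    ∀ᶠ n : ℕ in Filter.atTop, ((n : ℝ) + 1) * Real.exp (-c * n) ≤ ε := by
  have h1 : Filter.Tendsto (fun y : ℝ => (y + 1) * Real.exp (-c * y)) Filter.atTop (nhds 0) := by
    have ha := Real.tendsto_pow_mul_exp_neg_atTop_nhds_zero 1
    have hb := Real.tendsto_pow_mul_exp_neg_atTop_nhds_zero 0
    have hcy : Filter.Tendsto (fun y : ℝ => c * y) Filter.atTop Filter.atTop :=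
      Filter.tendsto_id.const_mul_atTop hc
    have := ((ha.comp hcy).const_mul c⁻¹).add (hb.comp hcy)
    simp only [mul_zero, add_zero] at this
    refine this.congr fun y => ?_
    simp only [Function.comp_apply, pow_one, pow_zero, neg_mul]
    field_simp
  filter_upwards [(h1.comp tendsto_natCast_atTop_atTop).eventually_le_const hε] with n hn using hn

/-- Lemma 2: for fixed `i` and `0 < δ < 1/2`, for all sufficiently
large `n`, `K_k^(n)(i) ≥ |K_k^(n)(x)|` for all `k ∈ [δn, (1/2−δ)n]` and `x ∈ [i, n−i]`. -/
theorem kraw_asymptotic_extremal (i : ℕ) (δ : ℝ) (hδ1 : 0 < δ) (hδ2 : δ < 1 / 2) :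
    ∃ N : ℕ, ∀ n ≥ N, ∀ k : ℕ, δ * n ≤ (k : ℝ) → (k : ℝ) ≤ (1 / 2 - δ) * n →
      ∀ x : ℝ, (i : ℝ) ≤ x → x ≤ (n : ℝ) - i → |kraw n k x| ≤ kraw n k (i : ℝ) := by
  have hev := (eventually_succ_mul_exp_le (c := δ ^ 2) (ε := δ ^ i) (by positivity)
    (by positivity)).and (((tendsto_natCast_atTop_atTop (R := ℝ)).const_mul_atTop
      (show 0 < δ ^ 2 by positivity)).eventually_ge_atTop ((i + 2 : ℕ) : ℝ))
  obtain ⟨N, hN⟩ := Filter.eventually_atTop.1 hev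
  refine ⟨N + 1, fun n hn k hk1 hk2 => ?_⟩
  obtain ⟨hexp, hi⟩ := hN n (by omega)
  have hn0 : 0 < n := by omega
  have hn' : (0 : ℝ) < n := by exact_mod_cast hn0
  have hδn : 0 < δ * n := by positivity
  have hk0 : 0 < k := by
    have : (0 : ℝ) < k := hδn.trans_le hk1
    exact_mod_cast this
  have hkn : 2 * k < n := by
    have : (2 : ℝ) * k < n := by linarith
    exact_mod_cast this
  have half (x : ℝ) (hix : i ≤ x) (hx : 2 * x ≤ n) : |kraw n k x| ≤ kraw n k i := by
    rcases le_total x k with hxk | hxk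
    · exact abs_kraw_le_of_le_succ hδ1 hn0 hk2 hi hix (by linarith)
    · have hp : δ ≤ k / n := by rwa [le_div_iff₀ hn']
      calc |kraw n k x| ≤ (n + 1) * Real.exp (-(k / n) ^ 2 * n) * n.choose k :=
            abs_kraw_le_mul_choose hk0 hkn hxk hx
        _ ≤ (n + 1) * Real.exp (-δ ^ 2 * n) * n.choose k := by gcongr
        _ ≤ δ ^ i * n.choose k := by gcongr
        _ ≤ kraw n k i := pow_mul_choose_le_kraw hδ1 hn0 hk2 (by push_cast at hi; linarith)
  intro x hix hxi
  rcases le_total (2 * x) n with hx | hx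
  · exact half x hix hx
  · have h := half (n - x) (by linarith) (by linarith)
    rwa [kraw_reflect, abs_mul, abs_pow, abs_neg, abs_one, one_pow, one_mul] at h
end
end
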